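/- In the descent algebra ΣD_4 of the Coxeter group D_4, the following identity holds: B_{[3,1]'} · B_{[4]} = B_{[3,1]} + B_{[1,3]} + 2 B_{[1,2,1]}, where [3,1]' is taken in C_4', [3,1] and [4] are taken in C_4, and [1,3], [1,2,1] are taken in C_1. -/

import Mathlib

open scoped Classical

namespace DescentD

/-- The domain on which the Coxeter group `D_n` acts: the pair `(k, b)` encodes the
integer `k + 1` if `b = true` and `-(k + 1)` if `b = false`.  (We use `Fin (n + 1)`
so that the type is always nonempty; only the points with `k < n` are moved.) -/
abbrev Dom (n : ℕ) := Fin (n + 1) × Bool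

/-- The point of `Dom n` encoding the nonzero integer `a` (for `1 ≤ |a| ≤ n`). -/
def pt (n : ℕ) (a : ℤ) : Dom n :=
  (⟨(a.natAbs - 1) % (n + 1), Nat.mod_lt _ n.succ_pos⟩, decide (0 < a))

/-- The transposition exchanging the points encoding `a` and `b`. -/
def swapD (n : ℕ) (a b : ℤ) : Equiv.Perm (Dom n) := Equiv.swap (pt n a) (pt n b)

/-- The Coxeter generators of `D_n`:  index `0` is `s_{1'} = (-2,1)(-1,2)` and index
`i` with `1 ≤ i ≤ n - 1` is `s_i = (-i-1,-i)(i,i+1)`. -/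
def gen (n : ℕ) (i : ℕ) : Equiv.Perm (Dom n) :=
  if i = 0 then swapD n (-2) 1 * swapD n (-1) 2
  else swapD n (-(i : ℤ) - 1) (-(i : ℤ)) * swapD n (i : ℤ) ((i : ℤ) + 1)

/-- The Coxeter group `D_n`, as the subgroup generated by `s_{1'}, s_1, …, s_{n-1}`. -/
def Dgroup (n : ℕ) : Subgroup (Equiv.Perm (Dom n)) :=
  Subgroup.closure (gen n '' Set.Iio n)

/-- Coxeter length of `w` with respect to the generators of `D_n`. -/
noncomputable def len (n : ℕ) (w : Equiv.Perm (Dom n)) : ℕ :=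
  sInf {k | ∃ l : List ℕ, (∀ i ∈ l, i < n) ∧ l.length = k ∧ (l.map (gen n)).prod = w}

/-- The parabolic subgroup `W_J` for a set `J` of generator indices. -/
def WJ (n : ℕ) (J : Set ℕ) : Subgroup (Equiv.Perm (Dom n)) :=
  Subgroup.closure (gen n '' J)

/-- The set `X_J` of minimal length left coset representatives of `W_J` in `D_n`. -/
def X (n : ℕ) (J : Set ℕ) : Set (Equiv.Perm (Dom n)) :=
  {w | w ∈ Dgroup n ∧ ∀ u ∈ WJ n J, len n w ≤ len n (w * u)}

/-- `𝒳_J`: the sum, in the group algebra `ℚ[D_n]`, of the minimal length left coset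
representatives of `W_J`. -/
noncomputable def XX (n : ℕ) (J : Set ℕ) : MonoidAlgebra ℚ (Equiv.Perm (Dom n)) :=
  ∑ w : Equiv.Perm (Dom n),
    if w ∈ X n J then MonoidAlgebra.of ℚ (Equiv.Perm (Dom n)) w else 0

/-- `q` is a composition of `m`: a list of positive integers with sum `m`. -/
def IsComposition (q : List ℕ) (m : ℕ) : Prop := (∀ x ∈ q, 0 < x) ∧ q.sum = m

/-- The four families making up `C(n)`:  `C_{<n}`, `C_1`, `C_n` and `C_n'`. -/
inductive Kind | lt | one | reg | prime
deriving DecidableEq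

/-- Membership of a composition in each of the four families of `C(n)`. -/
def memC (n : ℕ) : Kind → List ℕ → Prop
  | .lt, q => (∀ x ∈ q, 0 < x) ∧ q.sum + 2 ≤ n
  | .one, q => (∀ x ∈ q, 0 < x) ∧ q.sum = n ∧ q.headD 0 = 1
  | .reg, q => (∀ x ∈ q, 0 < x) ∧ q.sum = n ∧ 2 ≤ q.headD 0
  | .prime, q => (∀ x ∈ q, 0 < x) ∧ q.sum = n ∧ 2 ≤ q.headD 0

/-- The sum of the first `j` components of `q`. -/
def psum (q : List ℕ) (j : ℕ) : ℕ := (q.take j).sum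

/-- The subset of generator indices (`0` standing for `s_{1'}`, `i ≥ 1` for `s_i`)
corresponding to `q ∈ C(n)`. -/
def JofC (n : ℕ) : Kind → List ℕ → Set ℕ
  | .lt, q => {s | ∃ j < q.length, s = (n - q.sum) + psum q j}
  | .one, q => {0} ∪ {s | ∃ j, 1 ≤ j ∧ j < q.length ∧ s = psum q j}
  | .reg, q => {0} ∪ {s | ∃ j, 1 ≤ j ∧ j < q.length ∧ s = psum q j}
  | .prime, q => {1} ∪ {s | ∃ j, 1 ≤ j ∧ j < q.length ∧ s = psum q j}

/-- The basis element `B_q = 𝒳_{J^c}` of `ΣD_n`, for `q` in the family `k` of `C(n)`. -/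
noncomputable def B (n : ℕ) (k : Kind) (q : List ℕ) :
    MonoidAlgebra ℚ (Equiv.Perm (Dom n)) :=
  XX n (Set.Iio n \ JofC n k q)

/-- The points of `Dom 4`, in the order in which `code` lists their images. -/
def points : List (Dom 4) :=
  [(0, true), (1, true), (2, true), (3, true), (0, false), (1, false), (2, false), (3, false),
    (4, true), (4, false)]

/-- An order embedding of `Dom 4`, seen as `{-5, …, -1, 1, …, 5}`, into the natural numbers.
Negation becomes `v ↦ 9 - v`. -/
def rank (p : Dom 4) : ℕ := if p.2 = true then 5 + p.1.val else 4 - p.1.val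

/-- The one-line notation of a permutation of `Dom 4`. -/
def code (w : Equiv.Perm (Dom 4)) : List ℕ := points.map fun p => rank (w p)

/-- The effect on one-line notation of right multiplication by a Coxeter generator. -/
def step (c : List ℕ) (i : Fin 4) : List ℕ :=
  match i, c with
  | 0, [a, b, c, d, a₁, b₁, c₁, d₁, e, e₁] => [b₁, a₁, c, d, b, a, c₁, d₁, e, e₁]
  | 1, [a, b, c, d, a₁, b₁, c₁, d₁, e, e₁] => [b, a, c, d, b₁, a₁, c₁, d₁, e, e₁]
  | 2, [a, b, c, d, a₁, b₁, c₁, d₁, e, e₁] => [a, c, b, d, a₁, c₁, b₁, d₁, e, e₁]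
  | 3, [a, b, c, d, a₁, b₁, c₁, d₁, e, e₁] => [a, b, d, c, a₁, b₁, d₁, c₁, e, e₁]
  | _, c => c

/-- The group element spelled by a word in the Coxeter generators. -/
def word (l : List (Fin 4)) : Equiv.Perm (Dom 4) := (l.map fun i : Fin 4 => gen 4 i).prod

/-- The one-line notation of the group element spelled by a word. -/
def run (l : List (Fin 4)) : List ℕ := l.foldl step [5, 6, 7, 8, 4, 3, 2, 1, 9, 0]

/-- The contribution of the entries `a`, `b`, in this order, to the length. -/
def pairInv (a b : ℕ) : ℕ := (Nat.blt b a).toNat + (Nat.blt (a + b) 9).toNat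

/-- The number of inversions of type `D` of a one-line notation. -/
def inv (c : List ℕ) : ℕ :=
  match c with
  | a :: b :: c :: d :: _ =>
    pairInv a b + pairInv a c + pairInv a d + pairInv b c + pairInv b d + pairInv c d
  | _ => 0

/-- Reduced words for the elements of the parabolic subgroup generated by `s_1`, `s_2`. -/
def normalForms₂ : List (List (Fin 4)) :=
  [[], [2], [1, 2]].flatMap fun x => [[], [1]].map fun y => x ++ y

/-- Reduced words for the elements of the parabolic subgroup generated by `s_1`, `s_2`, `s_3`. -/
def normalForms₃ : List (List (Fin 4)) :=
  [[], [3], [2, 3], [1, 2, 3]].flatMap fun x => normalForms₂.map fun y => x ++ y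

/-- Reduced words for the elements of `D_4`. -/
def normalForms : List (List (Fin 4)) :=
  [[], [0], [2, 0], [1, 2, 0], [3, 2, 0], [1, 3, 2, 0], [2, 1, 3, 2, 0],
    [0, 2, 1, 3, 2, 0]].flatMap fun x => normalForms₃.map fun y => x ++ y

/-- Reduced words for the elements of the parabolic subgroup generated by `s_a` and `s_b`,
when these do not commute. -/
def dihedral (a b : Fin 4) : List (List (Fin 4)) :=
  [[], [a], [b], [a, b], [b, a], [a, b, a]]

/-- The words in `U` use only letters of `J` and represent a set closed under right
multiplication by `J`. -/
def isParabolic (J : List (Fin 4)) (U : List (List (Fin 4))) : Bool :=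
  let codes := U.map run
  U.contains [] && U.all fun u =>
    (u.all fun i => J.contains i) && J.all fun j => codes.contains (step (run u) j)

/-- The element spelled by `l` has no right descent in `J`. -/
def noDescent (J : List (Fin 4)) (l : List (Fin 4)) : Bool :=
  J.all fun j => Nat.ble (inv (run l)) (inv (step (run l) j))

/-- Normal forms without right descents in `J`. -/
def minimalForms (J : List (Fin 4)) : List (List (Fin 4)) := normalForms.filter (noDescent J)

/-- Elements without right descents in `J` are shortest in their coset of the subgroup
enumerated by `U`. -/
def isMinimal (J : List (Fin 4)) (U : List (List (Fin 4))) : Bool :=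
  (minimalForms J).all fun l => U.all fun u => Nat.ble (inv (run l)) (inv (run (l ++ u)))

theorem rank_injective : Function.Injective rank := by
  unfold Function.Injective; decide +kernel

theorem code_injective : Function.Injective code := by
  intro w w' h
  ext1 p
  have hp : p ∈ points := by revert p; decide +kernel
  exact rank_injective (List.map_inj_left.1 h p hp)

theorem gen_mul_self (i : Fin 4) : gen 4 i * gen 4 i = 1 := by
  ext1 p
  revert i p
  decide +kernel

theorem code_mul_gen (w : Equiv.Perm (Dom 4)) (i : Fin 4) :
    code (w * gen 4 i) = step (code w) i := by
  have key : ∀ i : Fin 4, points.map (gen 4 i) = match i with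
      | 0 => [(1, false), (0, false), (2, true), (3, true),
          (1, true), (0, true), (2, false), (3, false), (4, true), (4, false)]
      | 1 => [(1, true), (0, true), (2, true), (3, true),
          (1, false), (0, false), (2, false), (3, false), (4, true), (4, false)]
      | 2 => [(0, true), (2, true), (1, true), (3, true),
          (0, false), (2, false), (1, false), (3, false), (4, true), (4, false)]
      | 3 => [(0, true), (1, true), (3, true), (2, true),
          (0, false), (1, false), (3, false), (2, false), (4, true), (4, false)] := by
    decide +kernel
  have h : code (w * gen 4 i) = (points.map (gen 4 i)).map fun p => rank (w p) := by
    simp [code]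
  rw [h, key]
  fin_cases i <;> rfl

theorem word_append (l m : List (Fin 4)) : word (l ++ m) = word l * word m := by
  simp [word]

theorem word_concat (l : List (Fin 4)) (i : Fin 4) : word (l ++ [i]) = word l * gen 4 i := by
  simp [word]

theorem code_word (l : List (Fin 4)) : code (word l) = run l := by
  induction l using List.reverseRecOn with
  | nil => decide +kernel
  | append_singleton l i ih => rw [word_concat, code_mul_gen, ih]; simp [run]

theorem run_concat (l : List (Fin 4)) (i : Fin 4) : run (l ++ [i]) = step (run l) i := by
  simp [run]

theorem word_eq_iff {l m : List (Fin 4)} : word l = word m ↔ run l = run m := by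
  rw [← code_word, ← code_word, code_injective.eq_iff]

theorem mem_WJ_iff {J : List (Fin 4)} {U : List (List (Fin 4))} (h : isParabolic J U = true)
    {w : Equiv.Perm (Dom 4)} :
    w ∈ WJ 4 ((fun i : Fin 4 => (i : ℕ)) '' {i | i ∈ J}) ↔ ∃ u ∈ U, word u = w := by
  simp only [isParabolic, Bool.and_eq_true, List.all_eq_true, List.contains_iff_mem,
    List.mem_map] at h
  obtain ⟨h1, hU⟩ := h
  constructor
  · intro hw
    have hstep : ∀ x, (∃ u ∈ U, word u = x) → ∀ j ∈ J, ∃ u ∈ U, word u = x * gen 4 j := by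
      rintro _ ⟨u, hu, rfl⟩ j hj
      obtain ⟨v, hv, hvu⟩ := (hU u hu).2 j hj
      refine ⟨v, hv, ?_⟩
      rw [← word_concat, word_eq_iff, run_concat, hvu]
    induction hw using Subgroup.closure_induction_right with
    | one => exact ⟨[], h1, by simp [word]⟩
    | mul_right x hx y hy ih =>
      obtain ⟨_, ⟨j, hj, rfl⟩, rfl⟩ := hy
      exact hstep x ih j hj
    | mul_inv_cancel x hx y hy ih =>
      obtain ⟨_, ⟨j, hj, rfl⟩, rfl⟩ := hy
      rw [inv_eq_of_mul_eq_one_left (gen_mul_self j)]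
      exact hstep x ih j hj
  · rintro ⟨u, hu, rfl⟩
    refine Subgroup.list_prod_mem _ ?_
    simp only [List.mem_map, forall_exists_index, and_imp, forall_apply_eq_imp_iff₂]
    exact fun i hi => Subgroup.subset_closure ⟨i, ⟨i, (hU u hu).1 i hi, rfl⟩, rfl⟩

theorem image_val_mem_all :
    (fun i : Fin 4 => (i : ℕ)) '' {i | i ∈ [(0 : Fin 4), 1, 2, 3]} = Set.Iio 4 := by
  ext s
  constructor
  · rintro ⟨i, -, rfl⟩
    exact i.2
  · exact fun hs => ⟨⟨s, hs⟩, by generalize (⟨s, hs⟩ : Fin 4) = i; revert i; decide, rfl⟩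

theorem isParabolic_normalForms : isParabolic [0, 1, 2, 3] normalForms = true := by
  decide +kernel

theorem mem_Dgroup_iff {w : Equiv.Perm (Dom 4)} :
    w ∈ Dgroup 4 ↔ ∃ l ∈ normalForms, word l = w := by
  rw [← mem_WJ_iff isParabolic_normalForms, image_val_mem_all]
  rfl

theorem word_mem_Dgroup (l : List (Fin 4)) : word l ∈ Dgroup 4 := by
  refine Subgroup.list_prod_mem _ ?_
  simp only [List.mem_map, forall_exists_index, and_imp, forall_apply_eq_imp_iff₂]
  exact fun i _ => Subgroup.subset_closure ⟨i, i.2, rfl⟩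

theorem inv_step_le (l : List (Fin 4)) (i : Fin 4) : inv (step (run l) i) ≤ inv (run l) + 1 := by
  have key : ∀ l ∈ normalForms, ∀ i, inv (step (run l) i) ≤ inv (run l) + 1 := by
    decide +kernel
  obtain ⟨m, hm, hml⟩ := mem_Dgroup_iff.1 (word_mem_Dgroup l)
  rw [← word_eq_iff.1 hml]
  exact key m hm i

theorem inv_run_le_length (l : List (Fin 4)) : inv (run l) ≤ l.length := by
  induction l using List.reverseRecOn with
  | nil => decide +kernel
  | append_singleton l i ih =>
    rw [run_concat, List.length_append]
    exact (inv_step_le l i).trans (Nat.add_le_add_right ih 1)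

theorem len_word (l : List (Fin 4)) : len 4 (word l) = inv (run l) := by
  have key : ∀ l ∈ normalForms, l.length = inv (run l) := by decide +kernel
  obtain ⟨m, hm, hml⟩ := mem_Dgroup_iff.1 (word_mem_Dgroup l)
  refine IsLeast.csInf_eq ⟨⟨m.map fun i : Fin 4 => (i : ℕ), ?_, ?_, ?_⟩, ?_⟩
  · simp
  · rw [List.length_map, key m hm, word_eq_iff.1 hml]
  · rw [List.map_map, ← hml]
    rfl
  · rintro _ ⟨v, hv, rfl, hvl⟩
    lift v to List (Fin 4) using hv
    rw [List.map_map] at hvl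
    rw [← word_eq_iff.1 (show word v = word l from hvl), List.length_map]
    exact inv_run_le_length v

theorem word_mem_X_iff {J : List (Fin 4)} {U : List (List (Fin 4))}
    (hU : isParabolic J U = true) (hmin : isMinimal J U = true) {l : List (Fin 4)}
    (hl : l ∈ normalForms) :
    word l ∈ X 4 ((fun i : Fin 4 => (i : ℕ)) '' {i | i ∈ J}) ↔ l ∈ minimalForms J := by
  simp only [minimalForms, List.mem_filter, hl, true_and]
  constructor
  · rintro ⟨-, h⟩
    refine List.all_eq_true.2 fun j hj => Nat.ble_eq_true_of_le ?_
    have := h (gen 4 j) (Subgroup.subset_closure ⟨j, ⟨j, hj, rfl⟩, rfl⟩)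
    rwa [← word_concat, len_word, len_word, run_concat] at this
  · intro h
    refine ⟨word_mem_Dgroup l, fun w hw => ?_⟩
    obtain ⟨u, hu, rfl⟩ := (mem_WJ_iff hU).1 hw
    rw [← word_append, len_word, len_word]
    simp only [isMinimal, List.all_eq_true] at hmin
    exact Nat.le_of_ble_eq_true (hmin l (List.mem_filter.2 ⟨hl, h⟩) u hu)

/-- The group algebra element with a given one-line notation. -/
noncomputable def ofCode (c : List ℕ) : MonoidAlgebra ℚ (Equiv.Perm (Dom 4)) :=
  MonoidAlgebra.of ℚ (Equiv.Perm (Dom 4)) (Function.invFun code c)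

theorem ofCode_run (l : List (Fin 4)) :
    ofCode (run l) = MonoidAlgebra.of ℚ (Equiv.Perm (Dom 4)) (word l) := by
  rw [ofCode, ← code_word, Function.leftInverse_invFun code_injective]

theorem XX_eq_sum {J : List (Fin 4)} {U : List (List (Fin 4))}
    (hU : isParabolic J U = true) (hmin : isMinimal J U = true) :
    XX 4 ((fun i : Fin 4 => (i : ℕ)) '' {i | i ∈ J}) =
      (((minimalForms J).map run).map ofCode).sum := by
  have hnodup : (normalForms.map run).Nodup := by decide +kernel
  have hnodup' : ((minimalForms J).map word).Nodup := by
    refine List.Nodup.of_map code ?_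
    rw [List.map_map]
    have : code ∘ word = run := funext code_word
    rw [this]
    exact hnodup.sublist (List.filter_sublist.map run)
  have hmem : ∀ w, w ∈ X 4 ((fun i : Fin 4 => (i : ℕ)) '' {i | i ∈ J}) ↔
      w ∈ ((minimalForms J).map word).toFinset := by
    intro w
    simp only [List.mem_toFinset, List.mem_map]
    constructor
    · intro hw
      obtain ⟨l, hl, rfl⟩ := mem_Dgroup_iff.1 hw.1
      exact ⟨l, (word_mem_X_iff hU hmin hl).1 hw, rfl⟩
    · rintro ⟨l, hl, rfl⟩
      exact (word_mem_X_iff hU hmin (List.mem_of_mem_filter hl)).2 hl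
  simp only [XX, hmem]
  rw [Finset.sum_ite_mem, Finset.univ_inter, List.sum_toFinset _ hnodup', List.map_map,
    List.map_map]
  exact congrArg List.sum (List.map_congr_left fun l _ => (ofCode_run l).symm)

theorem sum_ofCode_mul_sum_ofCode (L M : List (List (Fin 4))) :
    ((L.map run).map ofCode).sum * ((M.map run).map ofCode).sum =
      (((L.flatMap fun l => M.map fun m => l ++ m).map run).map ofCode).sum := by
  induction L with
  | nil => simp
  | cons l L ih =>
    rw [List.map_cons, List.map_cons, List.sum_cons, add_mul, ih, List.flatMap_cons,
      List.map_append, List.map_append, List.sum_append, List.map_map, ← List.sum_map_mul_left,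
      List.map_map, List.map_map, List.map_map]
    congr 2
    refine List.map_congr_left fun m _ => ?_
    simp only [Function.comp_apply, ofCode_run, word_append, map_mul]

theorem partialSums_one (a : ℕ) :
    {s | ∃ j, 1 ≤ j ∧ j < [a].length ∧ s = psum [a] j} = ∅ := by
  refine Set.eq_empty_of_forall_notMem ?_
  rintro s ⟨j, h1, h2, -⟩
  simp only [List.length_cons, List.length_nil] at h2
  omega

theorem partialSums_two (a b : ℕ) :
    {s | ∃ j, 1 ≤ j ∧ j < [a, b].length ∧ s = psum [a, b] j} = {a} := by
  ext s
  constructor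
  · rintro ⟨j, h1, h2, rfl⟩
    obtain rfl : j = 1 := by simp only [List.length_cons, List.length_nil] at h2; omega
    simp [psum]
  · rintro rfl
    exact ⟨1, by simp [psum]⟩

theorem partialSums_three (a b c : ℕ) :
    {s | ∃ j, 1 ≤ j ∧ j < [a, b, c].length ∧ s = psum [a, b, c] j} = {a, a + b} := by
  ext s
  constructor
  · rintro ⟨j, h1, h2, rfl⟩
    obtain rfl | rfl : j = 1 ∨ j = 2 := by
      simp only [List.length_cons, List.length_nil] at h2; omega
    all_goals simp [psum]
  · rintro (rfl | rfl)
    · exact ⟨1, by simp [psum]⟩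
    · exact ⟨2, by simp [psum]⟩

theorem B_prime_three_one :
    B 4 Kind.prime [3, 1] = (((minimalForms [0, 2]).map run).map ofCode).sum := by
  rw [← XX_eq_sum (U := dihedral 0 2) (by decide +kernel) (by decide +kernel), B]
  congr 1
  ext s
  simp only [JofC, partialSums_two]
  simp
  omega

theorem B_reg_four :
    B 4 Kind.reg [4] = (((minimalForms [1, 2, 3]).map run).map ofCode).sum := by
  rw [← XX_eq_sum (U := normalForms₃) (by decide +kernel) (by decide +kernel), B]
  congr 1
  ext s
  simp only [JofC, partialSums_one]
  simp
  omega

theorem B_reg_three_one :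
    B 4 Kind.reg [3, 1] = (((minimalForms [1, 2]).map run).map ofCode).sum := by
  rw [← XX_eq_sum (U := normalForms₂) (by decide +kernel) (by decide +kernel), B]
  congr 1
  ext s
  simp only [JofC, partialSums_two]
  simp
  omega

theorem B_one_one_three :
    B 4 Kind.one [1, 3] = (((minimalForms [2, 3]).map run).map ofCode).sum := by
  rw [← XX_eq_sum (U := dihedral 2 3) (by decide +kernel) (by decide +kernel), B]
  congr 1
  ext s
  simp only [JofC, partialSums_two]
  simp
  omega

theorem B_one_one_two_one :
    B 4 Kind.one [1, 2, 1] = (((minimalForms [2]).map run).map ofCode).sum := by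
  rw [← XX_eq_sum (U := [[], [2]]) (by decide +kernel) (by decide +kernel), B]
  congr 1
  ext s
  simp only [JofC, partialSums_three]
  simp
  omega

/-- Example: `B_[3,1]ʹ B_[4] = B_[3,1] + B_[1,3] + 2B_[1,2,1]` in `ΣD_4`. -/
theorem example_mult_2 :
    B 4 Kind.prime [3, 1] * B 4 Kind.reg [4] =
      B 4 Kind.reg [3, 1] + B 4 Kind.one [1, 3] + (2 : ℚ) • B 4 Kind.one [1, 2, 1] := by
  have key : (((minimalForms [0, 2]).flatMap fun l =>
      (minimalForms [1, 2, 3]).map fun m => l ++ m).map run).Perm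
      ((minimalForms [1, 2]).map run ++ (minimalForms [2, 3]).map run ++
        ((minimalForms [2]).map run ++ (minimalForms [2]).map run)) := by
    decide +kernel
  rw [B_prime_three_one, B_reg_four, B_reg_three_one, B_one_one_three, B_one_one_two_one,
    sum_ofCode_mul_sum_ofCode, (key.map ofCode).sum_eq, two_smul]
  simp only [List.map_append, List.sum_append]

end DescentD
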